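/- Assume there is ε > 0 such that A(r) − εI is nonnegative definite for all r ∈ (0,T). Let f : (0,T)×ℝ^d → ℝ be bounded and measurable. Then the function u(t,x) := ∫_0^t (∫_{ℝ^d} f(s, x+y) p_{s,t}(y) dy) ds is locally integrable and is a weak solution of ∂_t u = a^{ij}(t) u_{x^i x^j} + f, u(0,·) = 0 on (0,T)×ℝ^d. -/

import Mathlib

open MeasureTheory Real Set
open scoped ENNReal NNReal

noncomputable section

/-- `ℝ^d`, modeled as `Fin d → ℝ`. -/
abbrev Rd (d : ℕ) := Fin d → ℝ

/-- The `i`-th partial derivative of `φ : ℝ^d → ℝ`. -/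
def pdrv (d : ℕ) (i : Fin d) (φ : Rd d → ℝ) : Rd d → ℝ :=
  fun x => fderiv ℝ φ x (Pi.single i 1)

/-- `u` is (measurable and) locally integrable on `(0,T) × ℝ^d`:
`∫_0^t ∫_{|x|<R} |u(s,x)| dx ds < ∞` for all `t ∈ (0,T)`, `R > 0`. -/
def LocInt (d : ℕ) (T : ℝ) (u : ℝ → Rd d → ℝ) : Prop :=
  Measurable (Function.uncurry u) ∧
  ∀ t ∈ Set.Ioo (0:ℝ) T, ∀ R : ℝ, 0 < R →
    (∫⁻ s in Set.Ioo (0:ℝ) t, ∫⁻ x in {x : Rd d | ∑ i, x i ^ 2 < R ^ 2},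
      ENNReal.ofReal |u s x|) < ⊤

/-- `u` is a weak solution of
`∂ₜ u = aⁱʲ(t) u_{xⁱxʲ} + bⁱ(t) u_{xⁱ} + c(t) u + f`, `u(0,·) = 0` on `(0,T) × ℝ^d`. -/
def IsWeakSol (d : ℕ) (T : ℝ) (a : Fin d → Fin d → ℝ → ℝ) (b : Fin d → ℝ → ℝ)
    (c : ℝ → ℝ) (f u : ℝ → Rd d → ℝ) : Prop :=
  ∀ φ : Rd d → ℝ, ContDiff ℝ (⊤ : ℕ∞) φ → HasCompactSupport φ →
    ∀ t ∈ Set.Ioo (0:ℝ) T,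
      (∫ x, u t x * φ x) =
      (∫ s in Set.Ioo (0:ℝ) t, ∫ x, u s x *
          ((∑ i, ∑ j, a i j s * pdrv d i (pdrv d j φ) x)
            + (∑ i, b i s * pdrv d i φ x) + c s * φ x)) +
      (∫ s in Set.Ioo (0:ℝ) t, ∫ x, f s x * φ x)

/-- Covariance matrix `Σ(s,t) = 2 ∫_s^t A(r) dr`. -/
def covMat (d : ℕ) (a : Fin d → Fin d → ℝ → ℝ) (s t : ℝ) : Matrix (Fin d) (Fin d) ℝ :=
  Matrix.of fun i j => 2 * ∫ r in Set.Ioo s t, a i j r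

/-- Centered Gaussian density with covariance matrix `S`. -/
def gaussKernel (d : ℕ) (S : Matrix (Fin d) (Fin d) ℝ) (y : Rd d) : ℝ :=
  (2 * Real.pi) ^ (-(d : ℝ) / 2) * S.det ^ (-(1 : ℝ) / 2) *
    Real.exp (-(∑ i, S⁻¹.mulVec y i * y i) / 2)

/-! ### A fundamental theorem of calculus for `exp (-∫ h)` -/

theorem AbsolutelyContinuousOnInterval.exp_neg {H : ℝ → ℝ} {a b : ℝ}
    (hH : AbsolutelyContinuousOnInterval H a b) (hnn : ∀ x ∈ uIcc a b, 0 ≤ H x) :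
    AbsolutelyContinuousOnInterval (fun x => Real.exp (-H x)) a b := by
  have key : ∀ x y : ℝ, 0 ≤ x → x ≤ y → Real.exp (-x) - Real.exp (-y) ≤ y - x := by
    intro x y hx hxy
    have h1 : Real.exp (-x) ≤ 1 := Real.exp_le_one_iff.2 (by linarith)
    have h2 := Real.add_one_le_exp (-(y - x))
    have h3 : Real.exp (-y) = Real.exp (-x) * Real.exp (-(y - x)) := by
      rw [← Real.exp_add]; ring_nf
    rw [h3]
    nlinarith [Real.exp_pos (-x)]
  have key2 : ∀ x y : ℝ, 0 ≤ x → 0 ≤ y → dist (Real.exp (-x)) (Real.exp (-y)) ≤ dist x y := by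
    intro x y hx hy
    rw [Real.dist_eq, Real.dist_eq]
    rcases le_total x y with h | h
    · rw [abs_of_nonneg (sub_nonneg.2 (Real.exp_le_exp.2 (by linarith))),
        abs_of_nonpos (by linarith)]
      linarith [key x y hx h]
    · rw [abs_of_nonpos (sub_nonpos.2 (Real.exp_le_exp.2 (by linarith))),
        abs_of_nonneg (by linarith)]
      linarith [key y x hy h]
  rw [absolutelyContinuousOnInterval_iff] at hH ⊢
  intro e he
  obtain ⟨δ, hδ, h⟩ := hH e he
  refine ⟨δ, hδ, fun E hE hlt => lt_of_le_of_lt (Finset.sum_le_sum fun i hi => ?_) (h E hE hlt)⟩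
  exact key2 _ _ (hnn _ (hE.1 i hi).1) (hnn _ (hE.1 i hi).2)

theorem setIntegral_mul_exp_neg_setIntegral {h : ℝ → ℝ} {s t : ℝ} (hst : s ≤ t)
    (hint : IntegrableOn h (Ioo s t)) (hnn : ∀ r ∈ Ioo s t, 0 ≤ h r) :
    ∫ r in Ioo s t, h r * Real.exp (-∫ q in Ioo s r, h q) =
      1 - Real.exp (-∫ q in Ioo s t, h q) := by
  have hii : IntervalIntegrable h volume s t := by
    rwa [intervalIntegrable_iff_integrableOn_Ioo_of_le hst]
  have hconv : ∀ r, s ≤ r → ∫ q in Ioo s r, h q = ∫ q in s..r, h q := fun r hr => by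
    rw [intervalIntegral.integral_of_le hr, integral_Ioc_eq_integral_Ioo]
  have hac := (hii.absolutelyContinuousOnInterval_intervalIntegral (c := s) (by simp)).exp_neg
    (by
      intro x hx
      rw [uIcc_of_le hst] at hx
      rw [← hconv x hx.1]
      exact setIntegral_nonneg measurableSet_Ioo fun r hr => hnn r ⟨hr.1, hr.2.trans_le hx.2⟩)
  have hftc := hac.integral_deriv_eq_sub
  have hae : ∀ᵐ x, x ∈ Ioo s t →
      deriv (fun x => Real.exp (-∫ q in s..x, h q)) x =
        -(h x * Real.exp (-∫ q in Ioo s x, h q)) := by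
    filter_upwards [hii.ae_hasDerivAt_integral] with x hx hxm
    have := ((hx (by rw [uIcc_of_le hst]; exact Ioo_subset_Icc_self hxm) s (by simp)).neg).exp
    rw [hconv x hxm.1.le]
    refine this.deriv.trans ?_
    simp only [Pi.neg_apply]
    ring
  rw [intervalIntegral.integral_of_le hst, integral_Ioc_eq_integral_Ioo,
    setIntegral_congr_ae measurableSet_Ioo hae, integral_neg] at hftc
  simp only [intervalIntegral.integral_same, neg_zero, Real.exp_zero] at hftc
  rw [hconv t hst]
  linarith

/-! ### Gaussian densities and their Fourier transform -/

theorem measurable_matrix_det {α : Type*} [MeasurableSpace α] {d : ℕ}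
    {M : α → Matrix (Fin d) (Fin d) ℝ} (hM : ∀ i j, Measurable fun x => M x i j) :
    Measurable fun x => (M x).det := by
  simp only [Matrix.det_apply]
  exact Finset.measurable_sum _ fun σ _ =>
    (Finset.measurable_prod _ fun i _ => hM _ _).const_smul _

theorem measurable_matrix_inv_apply {α : Type*} [MeasurableSpace α] {d : ℕ}
    {M : α → Matrix (Fin d) (Fin d) ℝ} (hM : ∀ i j, Measurable fun x => M x i j)
    (i j : Fin d) : Measurable fun x => (M x)⁻¹ i j := by
  simp only [Matrix.inv_def, Ring.inverse_eq_inv', Matrix.smul_apply, smul_eq_mul,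
    Matrix.adjugate_apply]
  refine (measurable_matrix_det hM).inv.mul (measurable_matrix_det fun k l => ?_)
  by_cases hk : k = j
  · subst hk; simp
  · simpa [Matrix.updateRow_ne hk] using hM k l

theorem measurable_gaussKernel_comp {α : Type*} [MeasurableSpace α] {d : ℕ}
    {M : α → Matrix (Fin d) (Fin d) ℝ} (hM : ∀ i j, Measurable fun x => M x i j)
    {y : α → Rd d} (hy : Measurable y) :
    Measurable fun x => gaussKernel d (M x) (y x) := by
  have hy' : ∀ i, Measurable fun x => y x i := fun i => (measurable_pi_apply i).comp hy
  have hinv := measurable_matrix_inv_apply hM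
  have hdet := measurable_matrix_det hM
  unfold gaussKernel
  simp only [Matrix.mulVec, dotProduct]
  refine ((hdet.pow_const _).const_mul _).mul (Measurable.exp (Measurable.div_const
    (Measurable.neg (Finset.measurable_sum _ fun i _ => Measurable.mul ?_ (hy' i))) _))
  exact Finset.measurable_sum _ fun j _ => (hinv i j).mul (hy' j)

theorem gaussKernel_neg (d : ℕ) (S : Matrix (Fin d) (Fin d) ℝ) (y : Rd d) :
    gaussKernel d S (-y) = gaussKernel d S y := by
  simp [gaussKernel, Matrix.mulVec_neg]

theorem gaussKernel_nonneg {d : ℕ} {S : Matrix (Fin d) (Fin d) ℝ} (hS : S.PosDef) (y : Rd d) :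
    0 ≤ gaussKernel d S y := by
  have := hS.det_pos
  unfold gaussKernel
  positivity

open scoped MatrixOrder in
theorem Matrix.PosDef.exists_eq_transpose_mul_self {d : ℕ} {S : Matrix (Fin d) (Fin d) ℝ}
    (hS : S.PosDef) : ∃ B : Matrix (Fin d) (Fin d) ℝ, S = B.transpose * B ∧ B.det ≠ 0 := by
  obtain ⟨B, hB⟩ := CStarAlgebra.nonneg_iff_eq_star_mul_self.1
    (Matrix.nonneg_iff_posSemidef.2 hS.posSemidef)
  have hB' : S = B.transpose * B := by
    rw [hB, Matrix.star_eq_conjTranspose, Matrix.conjTranspose_eq_transpose_of_trivial]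
  refine ⟨B, hB', fun h => hS.det_pos.ne' ?_⟩
  rw [hB', Matrix.det_mul, h, mul_zero]

theorem sum_quadratic_eq_dotProduct {d : ℕ} (S : Matrix (Fin d) (Fin d) ℝ) (ξ : Rd d) :
    ∑ i, ∑ j, S i j * ξ i * ξ j = ξ ⬝ᵥ (S.mulVec ξ) := by
  simp only [dotProduct, Matrix.mulVec, Finset.mul_sum]
  exact Finset.sum_congr rfl fun i _ => Finset.sum_congr rfl fun j _ => by ring

/-- The Gaussian density in the coordinates `y = Bᵀ x` with `S = Bᵀ B`. -/
theorem gaussKernel_transpose_mulVec {d : ℕ} {B : Matrix (Fin d) (Fin d) ℝ} (hB : B.det ≠ 0)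
    (x : Rd d) :
    gaussKernel d (B.transpose * B) (B.transpose.mulVec x) =
      (2 * Real.pi) ^ (-(d : ℝ) / 2) * |B.det|⁻¹ * Real.exp (-(1 / 2) * ∑ i, x i ^ 2) := by
  have hu : IsUnit B.det := isUnit_iff_ne_zero.2 hB
  have hut : IsUnit B.transpose.det := by rwa [Matrix.det_transpose]
  have h1 : ∑ i, ((B.transpose * B)⁻¹.mulVec (B.transpose.mulVec x)) i * B.transpose.mulVec x i
      = ∑ i, x i ^ 2 := by
    change (B.transpose * B)⁻¹.mulVec (B.transpose.mulVec x) ⬝ᵥ B.transpose.mulVec x = _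
    rw [Matrix.mulVec_mulVec, Matrix.mul_inv_rev, Matrix.mul_assoc,
      Matrix.nonsing_inv_mul _ hut, Matrix.mul_one, Matrix.dotProduct_mulVec,
      Matrix.vecMul_transpose, Matrix.mulVec_mulVec, Matrix.mul_nonsing_inv _ hu,
      Matrix.one_mulVec]
    simp [dotProduct, sq]
  have h2 : (B.transpose * B).det ^ (-(1 : ℝ) / 2) = |B.det|⁻¹ := by
    rw [Matrix.det_mul, Matrix.det_transpose, ← sq, ← sq_abs, ← Real.rpow_natCast,
      ← Real.rpow_mul (abs_nonneg _), ← Real.rpow_neg_one]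
    norm_num
  rw [gaussKernel, h1, h2]
  ring_nf

theorem continuous_gaussKernel (d : ℕ) (S : Matrix (Fin d) (Fin d) ℝ) :
    Continuous (gaussKernel d S) := by
  unfold gaussKernel
  simp only [Matrix.mulVec, dotProduct]
  fun_prop

theorem integrable_and_integral_gaussKernel_mul_cexp {d : ℕ} {S : Matrix (Fin d) (Fin d) ℝ}
    (hS : S.PosDef) (ξ : Rd d) :
    Integrable (fun y : Rd d => Complex.exp (2 * Real.pi * Complex.I * (∑ k, y k * ξ k : ℝ)) *
      (gaussKernel d S y : ℂ)) ∧
    ∫ y : Rd d, Complex.exp (2 * Real.pi * Complex.I * (∑ k, y k * ξ k : ℝ)) *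
      (gaussKernel d S y : ℂ) =
        (Real.exp (-(2 * Real.pi ^ 2 * ∑ i, ∑ j, S i j * ξ i * ξ j)) : ℂ) := by
  obtain ⟨B, rfl, hB⟩ := hS.exists_eq_transpose_mul_self
  have hBt : B.transpose.det ≠ 0 := by rwa [Matrix.det_transpose]
  set F : Rd d → ℂ := fun y =>
    Complex.exp (2 * Real.pi * Complex.I * (∑ k, y k * ξ k : ℝ)) *
      (gaussKernel d (B.transpose * B) y : ℂ) with hF
  have hFc : Continuous F := by
    have := continuous_gaussKernel d (B.transpose * B)
    fun_prop
  have hv : (volume : Measure (Rd d)) =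
      ENNReal.ofReal |B.det| • Measure.map (Matrix.toLin' B.transpose) volume := by
    rw [Real.map_matrix_volume_pi_eq_smul_volume_pi hBt, smul_smul, Matrix.det_transpose,
      ← ENNReal.ofReal_mul (abs_nonneg _), abs_inv, mul_inv_cancel₀ (abs_ne_zero.2 hB)]
    simp
  have hmeas : Measurable (Matrix.toLin' B.transpose : Rd d → Rd d) :=
    (LinearMap.continuous_of_finiteDimensional _).measurable
  have hcomp : ∀ x : Rd d, F (Matrix.toLin' B.transpose x) =
      ((2 * Real.pi) ^ (-(d : ℝ) / 2) * |B.det|⁻¹ : ℝ) *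
        Complex.exp (-(1 / 2 : ℂ) * ∑ i, (x i : ℂ) ^ 2 +
          ∑ i, (2 * Real.pi * Complex.I * (B.mulVec ξ i : ℂ)) * x i) := by
    intro x
    have h3 : ∑ k, B.transpose.mulVec x k * ξ k = ∑ i, B.mulVec ξ i * x i := by
      change B.transpose.mulVec x ⬝ᵥ ξ = B.mulVec ξ ⬝ᵥ x
      rw [Matrix.mulVec_transpose, ← Matrix.dotProduct_mulVec, dotProduct_comm]
    simp only [hF, Matrix.toLin'_apply]
    rw [gaussKernel_transpose_mulVec hB, h3, Complex.exp_add]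
    push_cast
    rw [Finset.mul_sum]
    simp only [mul_assoc]
    ring
  have hhalf : 0 < (1 / 2 : ℂ).re := by norm_num
  have hint := GaussianFourier.integrable_cexp_neg_mul_sum_add hhalf
    (fun i => 2 * Real.pi * Complex.I * (B.mulVec ξ i : ℂ))
  constructor
  · rw [hv]
    refine Integrable.smul_measure ?_ ENNReal.ofReal_ne_top
    rw [integrable_map_measure hFc.aestronglyMeasurable hmeas.aemeasurable]
    simp only [Function.comp_def, hcomp]
    exact hint.const_mul _
  · rw [hv, integral_smul_measure, integral_map hmeas.aemeasurable hFc.aestronglyMeasurable]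
    simp only [hcomp]
    rw [integral_const_mul, GaussianFourier.integral_cexp_neg_mul_sum_add hhalf]
    rw [ENNReal.toReal_ofReal (abs_nonneg _)]
    have h4 : ((Real.pi : ℂ) / (1 / 2)) ^ ((Fintype.card (Fin d) : ℂ) / 2) =
        (((2 * Real.pi) ^ ((d : ℝ) / 2) : ℝ) : ℂ) := by
      rw [Complex.ofReal_cpow (by positivity)]
      push_cast
      rw [Fintype.card_fin]
      congr 1
      ring
    have h5 : ∑ i, ∑ j, (B.transpose * B) i j * ξ i * ξ j = ∑ i, (B.mulVec ξ i) ^ 2 := by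
      rw [sum_quadratic_eq_dotProduct, ← Matrix.mulVec_mulVec, Matrix.dotProduct_mulVec,
        Matrix.vecMul_transpose]
      simp [dotProduct, sq]
    have h6 : (∑ i, (2 * Real.pi * Complex.I * (B.mulVec ξ i : ℂ)) ^ 2) / (4 * (1 / 2)) =
        ((-(2 * Real.pi ^ 2 * ∑ i, (B.mulVec ξ i) ^ 2) : ℝ) : ℂ) := by
      push_cast
      simp only [mul_pow, Complex.I_sq, ← Finset.mul_sum]
      ring
    rw [h4, h5, h6, Complex.real_smul, ← Complex.ofReal_exp]
    have h7 : (2 * Real.pi) ^ (-(d : ℝ) / 2) * (2 * Real.pi) ^ ((d : ℝ) / 2) = 1 := by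
      rw [← Real.rpow_add (by positivity), neg_div, neg_add_cancel, Real.rpow_zero]
    have h8 : |B.det| * |B.det|⁻¹ = 1 := mul_inv_cancel₀ (abs_ne_zero.2 hB)
    simp only [← Complex.ofReal_mul]
    congr 1
    generalize Real.exp (-(2 * Real.pi ^ 2 * ∑ i, (B.mulVec ξ i) ^ 2)) = E
    calc _ = (|B.det| * |B.det|⁻¹) * ((2 * Real.pi) ^ (-(d : ℝ) / 2) *
          (2 * Real.pi) ^ ((d : ℝ) / 2)) * E := by
          generalize (2 * Real.pi) ^ (-(d : ℝ) / 2) = p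
          ring
      _ = E := by rw [h7, h8]; ring

theorem integrable_gaussKernel {d : ℕ} {S : Matrix (Fin d) (Fin d) ℝ} (hS : S.PosDef) :
    Integrable (gaussKernel d S) := by
  have := (integrable_and_integral_gaussKernel_mul_cexp hS 0).1.re
  simpa using this

theorem integral_gaussKernel {d : ℕ} {S : Matrix (Fin d) (Fin d) ℝ} (hS : S.PosDef) :
    ∫ y, gaussKernel d S y = 1 := by
  have := (integrable_and_integral_gaussKernel_mul_cexp hS 0).2
  simp only [Pi.zero_apply, mul_zero, Finset.sum_const_zero, Complex.ofReal_zero, Complex.exp_zero,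
    one_mul, neg_zero, Real.exp_zero, Complex.ofReal_one] at this
  rw [integral_complex_ofReal] at this
  exact_mod_cast this

/-! ### Fourier representation of a test function -/

theorem contDiff_pdrv {d : ℕ} {φ : Rd d → ℝ} (hφ : ContDiff ℝ (⊤ : ℕ∞) φ) (i : Fin d) :
    ContDiff ℝ (⊤ : ℕ∞) (pdrv d i φ) :=
  (hφ.fderiv_right (by simp)).clm_apply contDiff_const

theorem HasCompactSupport.pdrv {d : ℕ} {φ : Rd d → ℝ} (hφ : HasCompactSupport φ) (i : Fin d) :
    HasCompactSupport (pdrv d i φ) :=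
  hφ.fderiv_apply (𝕜 := ℝ) _

open scoped FourierTransform LineDeriv SchwartzMap in
theorem SchwartzMap.apply_toLp_eq_integral {d : ℕ} (f : 𝓢(EuclideanSpace ℝ (Fin d), ℂ))
    (x : Rd d) :
    f (WithLp.toLp 2 x) = ∫ ξ : Rd d, 𝓕 f (WithLp.toLp 2 ξ) *
      Complex.exp (2 * Real.pi * Complex.I * (∑ k, x k * ξ k : ℝ)) := by
  have h1 : f = 𝓕⁻ (𝓕 f) := (FourierTransform.fourierInv_fourier_eq f).symm
  conv_lhs => rw [h1]
  rw [SchwartzMap.fourierInv_coe, Real.fourierInv_eq',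
    ← (PiLp.volume_preserving_toLp (Fin d)).integral_comp
      (MeasurableEquiv.toLp 2 (Fin d → ℝ)).measurableEmbedding]
  refine integral_congr_ae (Filter.Eventually.of_forall fun ξ => ?_)
  simp only [PiLp.inner_apply, RCLike.inner_apply, conj_trivial, smul_eq_mul]
  rw [mul_comm]
  congr 2
  push_cast
  ring

open scoped FourierTransform LineDeriv SchwartzMap in
theorem exists_fourier_repr {d : ℕ} {φ : Rd d → ℝ} (hφ : ContDiff ℝ (⊤ : ℕ∞) φ)
    (hc : HasCompactSupport φ) :
    ∃ G : Rd d → ℂ, Integrable G ∧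
      (∀ i j, Integrable fun ξ : Rd d => -(4 * Real.pi ^ 2) * ((ξ i * ξ j : ℝ) : ℂ) * G ξ) ∧
      (∀ x, (φ x : ℂ) = ∫ ξ : Rd d, G ξ *
        Complex.exp (2 * Real.pi * Complex.I * (∑ k, x k * ξ k : ℝ))) ∧
      (∀ i j x, (pdrv d i (pdrv d j φ) x : ℂ) =
        ∫ ξ : Rd d, (-(4 * Real.pi ^ 2) * ((ξ i * ξ j : ℝ) : ℂ) * G ξ) *
          Complex.exp (2 * Real.pi * Complex.I * (∑ k, x k * ξ k : ℝ))) := by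
  have hg : ContDiff ℝ (⊤ : ℕ∞) fun v : EuclideanSpace ℝ (Fin d) => (φ (WithLp.ofLp v) : ℂ) :=
    Complex.ofRealCLM.contDiff.comp
      (hφ.comp (PiLp.continuousLinearEquiv 2 ℝ fun _ : Fin d => ℝ).contDiff)
  have hgc : HasCompactSupport fun v : EuclideanSpace ℝ (Fin d) => (φ (WithLp.ofLp v) : ℂ) := by
    have h1 : HasCompactSupport fun v : EuclideanSpace ℝ (Fin d) => φ (WithLp.ofLp v) :=
      hc.comp_homeomorph (PiLp.homeomorph 2 fun _ : Fin d => ℝ)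
    exact h1.comp_left Complex.ofReal_zero
  set g : 𝓢(EuclideanSpace ℝ (Fin d), ℂ) := hgc.toSchwartzMap hg with hgdef
  have hderiv : ∀ ψ : Rd d → ℝ, Differentiable ℝ ψ → ∀ (i : Fin d) v,
      fderiv ℝ (fun v : EuclideanSpace ℝ (Fin d) => (ψ (WithLp.ofLp v) : ℂ)) v
        (EuclideanSpace.single i 1) = (pdrv d i ψ (WithLp.ofLp v) : ℂ) := by
    intro ψ hψ i v
    have h1 : HasFDerivAt (fun v : EuclideanSpace ℝ (Fin d) => (ψ (WithLp.ofLp v) : ℂ)) _ v :=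
      Complex.ofRealCLM.hasFDerivAt.comp v ((hψ (WithLp.ofLp v)).hasFDerivAt.comp v
        (PiLp.continuousLinearEquiv 2 ℝ (fun _ : Fin d => ℝ)).hasFDerivAt)
    rw [h1.fderiv]
    simp only [pdrv, ContinuousLinearMap.comp_apply, Complex.ofRealCLM_apply]
    rfl
  set D : Fin d → Fin d → 𝓢(EuclideanSpace ℝ (Fin d), ℂ) := fun i j =>
    ∂_{(EuclideanSpace.single i 1 : EuclideanSpace ℝ (Fin d))}
      (∂_{(EuclideanSpace.single j 1 : EuclideanSpace ℝ (Fin d))} g) with hD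
  have hDval : ∀ i j x, D i j (WithLp.toLp 2 x) = (pdrv d i (pdrv d j φ) x : ℂ) := by
    intro i j x
    have h1 : ⇑(∂_{(EuclideanSpace.single j 1 : EuclideanSpace ℝ (Fin d))} g :
        𝓢(EuclideanSpace ℝ (Fin d), ℂ)) = fun v => (pdrv d j φ (WithLp.ofLp v) : ℂ) := by
      ext v
      rw [SchwartzMap.lineDerivOp_apply_eq_fderiv]
      exact hderiv φ (hφ.differentiable (by simp)) j v
    rw [hD]
    simp only
    rw [SchwartzMap.lineDerivOp_apply_eq_fderiv, h1]
    exact hderiv _ ((contDiff_pdrv hφ j).differentiable (by simp)) i _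
  have hDF : ∀ i j (ξ : Rd d), 𝓕 (D i j) (WithLp.toLp 2 ξ) =
      -(4 * Real.pi ^ 2) * ((ξ i * ξ j : ℝ) : ℂ) * 𝓕 g (WithLp.toLp 2 ξ) := by
    intro i j ξ
    have h1 : ∀ (f : 𝓢(EuclideanSpace ℝ (Fin d), ℂ)) (k : Fin d),
        𝓕 (∂_{(EuclideanSpace.single k 1 : EuclideanSpace ℝ (Fin d))} f) (WithLp.toLp 2 ξ) =
          2 * Real.pi * Complex.I * (ξ k * 𝓕 f (WithLp.toLp 2 ξ)) := by
      intro f k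
      have ht : (fun v : EuclideanSpace ℝ (Fin d) =>
          inner ℝ v (EuclideanSpace.single k (1 : ℝ))).HasTemperateGrowth := by
        fun_prop
      rw [SchwartzMap.fourier_lineDerivOp_eq, smul_apply,
        SchwartzMap.smulLeftCLM_apply_apply ht, EuclideanSpace.inner_single_right]
      simp
    rw [hD]
    simp only
    rw [h1, h1, Complex.ofReal_mul]
    linear_combination (4 * (Real.pi : ℂ) ^ 2 * ξ i * ξ j * 𝓕 g (WithLp.toLp 2 ξ)) *
      Complex.I_sq
  have hint : ∀ f : 𝓢(EuclideanSpace ℝ (Fin d), ℂ),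
      Integrable fun ξ : Rd d => f (WithLp.toLp 2 ξ) := fun f =>
    ((PiLp.volume_preserving_toLp (Fin d)).integrable_comp_emb
      (MeasurableEquiv.toLp 2 (Fin d → ℝ)).measurableEmbedding).2 f.integrable
  refine ⟨fun ξ => 𝓕 g (WithLp.toLp 2 ξ), hint _, fun i j => ?_, fun x => ?_, fun i j x => ?_⟩
  · simpa only [hDF] using hint (𝓕 (D i j))
  · exact g.apply_toLp_eq_integral x
  · rw [← hDval, (D i j).apply_toLp_eq_integral]
    simp only [hDF]

/-! ### Gaussian averages -/

/-- The Gaussian average `z ↦ ∫ ψ(z + y) p_S(y) dy`. -/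
def gaussAvg (d : ℕ) (S : Matrix (Fin d) (Fin d) ℝ) (ψ : Rd d → ℝ) (z : Rd d) : ℝ :=
  ∫ y, ψ (z + y) * gaussKernel d S y

theorem gaussAvg_eq_integral_fourier {d : ℕ} {S : Matrix (Fin d) (Fin d) ℝ} (hS : S.PosDef)
    {ψ : Rd d → ℝ} {G : Rd d → ℂ} (hG : Integrable G)
    (hψ : ∀ x, (ψ x : ℂ) = ∫ ξ : Rd d, G ξ *
      Complex.exp (2 * Real.pi * Complex.I * (∑ k, x k * ξ k : ℝ))) (z : Rd d) :
    (gaussAvg d S ψ z : ℂ) = ∫ ξ : Rd d, G ξ *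
      Complex.exp (2 * Real.pi * Complex.I * (∑ k, z k * ξ k : ℝ)) *
      (Real.exp (-(2 * Real.pi ^ 2 * ∑ i, ∑ j, S i j * ξ i * ξ j)) : ℂ) := by
  have hexp : ∀ y ξ : Rd d,
      Complex.exp (2 * Real.pi * Complex.I * (∑ k, (z + y) k * ξ k : ℝ)) =
      Complex.exp (2 * Real.pi * Complex.I * (∑ k, z k * ξ k : ℝ)) *
        Complex.exp (2 * Real.pi * Complex.I * (∑ k, y k * ξ k : ℝ)) := by
    intro y ξ
    rw [← Complex.exp_add]
    congr 1
    simp only [Pi.add_apply, add_mul, Finset.sum_add_distrib]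
    push_cast
    ring
  have hnorm : ∀ y ξ : Rd d,
      ‖Complex.exp (2 * Real.pi * Complex.I * (∑ k, (z + y) k * ξ k : ℝ))‖ = 1 := by
    intro y ξ
    have := Complex.norm_exp_ofReal_mul_I (2 * Real.pi * ∑ k, (z + y) k * ξ k)
    rw [← this]
    congr 2
    push_cast
    ring
  have hint : Integrable (Function.uncurry fun y ξ : Rd d => G ξ *
      Complex.exp (2 * Real.pi * Complex.I * (∑ k, (z + y) k * ξ k : ℝ)) *
        (gaussKernel d S y : ℂ)) (volume.prod volume) := by
    have h1 : Integrable (fun p : Rd d × Rd d => (gaussKernel d S p.1 : ℂ) * G p.2)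
        (volume.prod volume) :=
      (integrable_gaussKernel hS).ofReal.mul_prod hG
    have h2 := h1.bdd_mul (c := 1) (f := fun p : Rd d × Rd d =>
      Complex.exp (2 * Real.pi * Complex.I * (∑ k, (z + p.1) k * p.2 k : ℝ)))
      (Continuous.aestronglyMeasurable (by fun_prop))
      (Filter.Eventually.of_forall fun p => (hnorm p.1 p.2).le)
    refine h2.congr (Filter.Eventually.of_forall fun p => ?_)
    simp only [Function.uncurry]
    ring
  rw [gaussAvg, ← integral_complex_ofReal]
  calc ∫ y, ((ψ (z + y) * gaussKernel d S y : ℝ) : ℂ)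
      = ∫ y, ∫ ξ : Rd d, G ξ *
        Complex.exp (2 * Real.pi * Complex.I * (∑ k, (z + y) k * ξ k : ℝ)) *
          (gaussKernel d S y : ℂ) := by
        refine integral_congr_ae (Filter.Eventually.of_forall fun y => ?_)
        simp only
        rw [integral_mul_const, ← hψ, Complex.ofReal_mul]
    _ = ∫ ξ : Rd d, ∫ y, G ξ *
        Complex.exp (2 * Real.pi * Complex.I * (∑ k, (z + y) k * ξ k : ℝ)) *
          (gaussKernel d S y : ℂ) := integral_integral_swap hint
    _ = _ := by
        refine integral_congr_ae (Filter.Eventually.of_forall fun ξ => ?_)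
        simp only [hexp]
        rw [← (integrable_and_integral_gaussKernel_mul_cexp hS ξ).2, ← integral_const_mul]
        refine integral_congr_ae (Filter.Eventually.of_forall fun y => ?_)
        simp only
        ring

/-! ### The covariance matrices -/

theorem quadratic_covMat {d : ℕ} {a : Fin d → Fin d → ℝ → ℝ} {s t : ℝ}
    (hint : ∀ i j, IntegrableOn (a i j) (Ioo s t)) (ξ : Rd d) :
    ∑ i, ∑ j, covMat d a s t i j * ξ i * ξ j =
      2 * ∫ r in Ioo s t, ∑ i, ∑ j, a i j r * ξ i * ξ j := by
  have h1 : ∀ i j, Integrable (fun r => a i j r * ξ i * ξ j) (volume.restrict (Ioo s t)) :=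
    fun i j => ((hint i j).mul_const _).mul_const _
  rw [integral_finsetSum _ fun i _ => integrable_finsetSum _ fun j _ => h1 i j, Finset.mul_sum]
  refine Finset.sum_congr rfl fun i _ => ?_
  rw [integral_finsetSum _ fun j _ => h1 i j, Finset.mul_sum]
  refine Finset.sum_congr rfl fun j _ => ?_
  rw [integral_mul_const, integral_mul_const]
  simp only [covMat, Matrix.of_apply]
  ring

theorem posDef_covMat {d : ℕ} {a : Fin d → Fin d → ℝ → ℝ} {s t ε : ℝ} (hst : s < t)
    (hε : 0 < ε) (hint : ∀ i j, IntegrableOn (a i j) (Ioo s t))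
    (hsymm : ∀ r ∈ Ioo s t, ∀ i j, a i j r = a j i r)
    (hunif : ∀ r ∈ Ioo s t, ∀ ξ : Fin d → ℝ,
      ε * ∑ i, ξ i ^ 2 ≤ ∑ i, ∑ j, a i j r * ξ i * ξ j) :
    (covMat d a s t).PosDef := by
  refine Matrix.PosDef.of_dotProduct_mulVec_pos ?_ fun {ξ} hξ => ?_
  · ext i j
    simp only [Matrix.conjTranspose_apply, covMat, Matrix.of_apply, star_trivial]
    rw [setIntegral_congr_fun measurableSet_Ioo fun r hr => hsymm r hr j i]
  · rw [star_trivial, ← sum_quadratic_eq_dotProduct, quadratic_covMat hint]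
    have hpos : 0 < ∑ i, ξ i ^ 2 := by
      obtain ⟨k, hk⟩ := Function.ne_iff.1 hξ
      exact Finset.sum_pos' (fun i _ => sq_nonneg _) ⟨k, Finset.mem_univ _, by
        have : ξ k ≠ 0 := hk
        positivity⟩
    have h1 : ∫ r in Ioo s t, ε * ∑ i, ξ i ^ 2 ≤
        ∫ r in Ioo s t, ∑ i, ∑ j, a i j r * ξ i * ξ j :=
      setIntegral_mono_on (integrableOn_const (by simp))
        (integrable_finsetSum _ fun i _ => integrable_finsetSum _ fun j _ =>
          ((hint i j).mul_const _).mul_const _)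
        measurableSet_Ioo fun r hr => hunif r hr ξ
    rw [setIntegral_const, Real.volume_real_Ioo_of_le hst.le, smul_eq_mul] at h1
    have := mul_pos (sub_pos.2 hst) (mul_pos hε hpos)
    linarith

theorem measurable_covMat_apply {d : ℕ} {a : Fin d → Fin d → ℝ → ℝ}
    (ha : ∀ i j, Measurable (a i j)) (i j : Fin d) :
    Measurable fun p : ℝ × ℝ => covMat d a p.1 p.2 i j := by
  simp only [covMat, Matrix.of_apply]
  refine Measurable.const_mul ?_ _
  have h1 : ∀ p : ℝ × ℝ, ∫ r in Ioo p.1 p.2, a i j r =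
      ∫ r, (if p.1 < r ∧ r < p.2 then a i j r else 0) := by
    intro p
    rw [← integral_indicator measurableSet_Ioo]
    simp only [indicator, mem_Ioo]
  simp only [h1]
  have h2 : Measurable fun q : (ℝ × ℝ) × ℝ =>
      if q.1.1 < q.2 ∧ q.2 < q.1.2 then a i j q.2 else 0 := by
    refine Measurable.ite ?_ ((ha i j).comp measurable_snd) measurable_const
    exact (measurableSet_lt (measurable_fst.comp measurable_fst) measurable_snd).inter
      (measurableSet_lt measurable_snd (measurable_snd.comp measurable_fst))
  exact (h2.stronglyMeasurable.integral_prod_right').measurable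

/-! ### The Kolmogorov equation for Gaussian averages -/

theorem norm_cexp_two_pi_mul_I (x : ℝ) :
    ‖Complex.exp (2 * Real.pi * Complex.I * (x : ℂ))‖ = 1 := by
  rw [← Complex.norm_exp_ofReal_mul_I (2 * Real.pi * x)]
  congr 2
  push_cast
  ring

theorem Matrix.PosDef.exp_neg_quadratic_le_one {d : ℕ} {S : Matrix (Fin d) (Fin d) ℝ}
    (hS : S.PosDef) (ξ : Rd d) :
    Real.exp (-(2 * Real.pi ^ 2 * ∑ i, ∑ j, S i j * ξ i * ξ j)) ≤ 1 := by
  have h : 0 ≤ ∑ i, ∑ j, S i j * ξ i * ξ j := by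
    rw [sum_quadratic_eq_dotProduct]
    simpa using hS.posSemidef.dotProduct_mulVec_nonneg ξ
  rw [Real.exp_le_one_iff, neg_nonpos]
  positivity

theorem measurable_exp_neg_covMat {d : ℕ} {a : Fin d → Fin d → ℝ → ℝ}
    (ha : ∀ i j, Measurable (a i j)) (s : ℝ) :
    Measurable fun p : ℝ × Rd d =>
      Real.exp (-(2 * Real.pi ^ 2 * ∑ i, ∑ j, covMat d a s p.1 i j * p.2 i * p.2 j)) := by
  have h0 : ∀ i j, Measurable fun p : ℝ × Rd d => covMat d a s p.1 i j := fun i j =>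
    (measurable_covMat_apply ha i j).comp (measurable_const.prodMk measurable_fst)
  have h1 : Measurable fun p : ℝ × Rd d => ∑ i, ∑ j, covMat d a s p.1 i j * p.2 i * p.2 j :=
    Finset.measurable_sum _ fun i _ => Finset.measurable_sum _ fun j _ =>
      ((h0 i j).mul ((measurable_pi_apply i).comp measurable_snd)).mul
        ((measurable_pi_apply j).comp measurable_snd)
  exact Real.measurable_exp.comp (h1.const_mul (2 * Real.pi ^ 2)).neg

theorem gaussAvg_eq_add_integral {d : ℕ} {a : Fin d → Fin d → ℝ → ℝ}
    (ha : ∀ i j, Measurable (a i j)) {s t ε : ℝ} (hst : s < t) (hε : 0 < ε)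
    (hint : ∀ i j, IntegrableOn (a i j) (Ioo s t))
    (hsymm : ∀ r ∈ Ioo s t, ∀ i j, a i j r = a j i r)
    (hunif : ∀ r ∈ Ioo s t, ∀ ξ : Fin d → ℝ,
      ε * ∑ i, ξ i ^ 2 ≤ ∑ i, ∑ j, a i j r * ξ i * ξ j)
    {φ : Rd d → ℝ} (hφ : ContDiff ℝ (⊤ : ℕ∞) φ) (hc : HasCompactSupport φ) (z : Rd d) :
    gaussAvg d (covMat d a s t) φ z = φ z + ∫ r in Ioo s t,
      ∑ i, ∑ j, a i j r * gaussAvg d (covMat d a s r) (pdrv d i (pdrv d j φ)) z := by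
  obtain ⟨G, hG, hG2, hrep, hrep2⟩ := exists_fourier_repr hφ hc
  have hsub : ∀ r ∈ Ioo s t, Ioo s r ⊆ Ioo s t := fun r hr => Ioo_subset_Ioo_right hr.2.le
  have hpd : ∀ r ∈ Ioo s t, (covMat d a s r).PosDef := fun r hr =>
    posDef_covMat hr.1 hε (fun i j => (hint i j).mono_set (hsub r hr))
      (fun q hq => hsymm q (hsub r hr hq)) (fun q hq => hunif q (hsub r hr hq))
  have hpdt : (covMat d a s t).PosDef := posDef_covMat hst hε hint hsymm hunif
  obtain ⟨e, he⟩ : ∃ e : Rd d → ℂ, ∀ ξ, e ξ =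
      Complex.exp (2 * Real.pi * Complex.I * (∑ k, z k * ξ k : ℝ)) := ⟨_, fun _ => rfl⟩
  obtain ⟨E, hE⟩ : ∃ E : ℝ → Rd d → ℝ, ∀ r ξ, E r ξ =
      Real.exp (-(2 * Real.pi ^ 2 * ∑ i, ∑ j, covMat d a s r i j * ξ i * ξ j)) :=
    ⟨_, fun _ _ => rfl⟩
  have he_norm : ∀ ξ, ‖e ξ‖ = 1 := fun ξ => by rw [he, norm_cexp_two_pi_mul_I]
  have he_cont : Continuous e := by
    rw [funext he]
    fun_prop
  have hE_norm : ∀ r ξ, (covMat d a s r).PosDef → ‖(E r ξ : ℂ)‖ ≤ 1 := by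
    intro r ξ hr
    rw [Complex.norm_real, hE, Real.norm_of_nonneg (Real.exp_pos _).le]
    exact hr.exp_neg_quadratic_le_one ξ
  have hE_le : ∀ r ∈ Ioo s t, ∀ ξ, ‖e ξ * (E r ξ : ℂ)‖ ≤ 1 := by
    intro r hr ξ
    rw [norm_mul, he_norm, one_mul]
    exact hE_norm r ξ (hpd r hr)
  have hE_meas : Measurable fun p : ℝ × Rd d => E p.1 p.2 := by
    simp only [hE]
    exact measurable_exp_neg_covMat ha s
  have hE_meas' : ∀ r, Measurable (E r) := fun r =>
    hE_meas.comp (measurable_const.prodMk measurable_id : Measurable fun ξ : Rd d => (r, ξ))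
  obtain ⟨k, hk⟩ : ∃ k : Fin d → Fin d → ℝ → Rd d → ℂ, ∀ i j r ξ, k i j r ξ =
      (e ξ * (E r ξ : ℂ)) *
        ((a i j r : ℂ) * (-(4 * Real.pi ^ 2) * ((ξ i * ξ j : ℝ) : ℂ) * G ξ)) :=
    ⟨_, fun _ _ _ _ => rfl⟩
  have hkξ : ∀ i j, ∀ r ∈ Ioo s t, Integrable (k i j r) := by
    intro i j r hr
    rw [funext (hk i j r)]
    refine ((hG2 i j).const_mul (a i j r : ℂ)).bdd_mul (c := 1)
      (Measurable.aestronglyMeasurable ?_) (Filter.Eventually.of_forall (hE_le r hr))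
    exact he_cont.measurable.mul (Complex.measurable_ofReal.comp (hE_meas' r))
  have hkprod : ∀ i j, Integrable (Function.uncurry (k i j))
      ((volume.restrict (Ioo s t)).prod volume) := by
    intro i j
    rw [show Function.uncurry (k i j) = fun p : ℝ × Rd d => (e p.2 * (E p.1 p.2 : ℂ)) *
      ((a i j p.1 : ℂ) * (-(4 * Real.pi ^ 2) * ((p.2 i * p.2 j : ℝ) : ℂ) * G p.2)) from
      funext fun p => hk i j p.1 p.2]
    refine Integrable.bdd_mul (c := 1) ((hint i j).ofReal.mul_prod (hG2 i j))
      (Measurable.aestronglyMeasurable ?_) ?_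
    · exact (he_cont.measurable.comp measurable_snd).mul (Complex.measurable_ofReal.comp hE_meas)
    · have h1 : ∀ᵐ r ∂(volume.restrict (Ioo s t)), r ∈ Ioo s t :=
        ae_restrict_mem measurableSet_Ioo
      filter_upwards [Measure.quasiMeasurePreserving_fst.ae h1] with p hp
      exact hE_le p.1 hp p.2
  have hKprod : Integrable (Function.uncurry fun r ξ => ∑ i, ∑ j, k i j r ξ)
      ((volume.restrict (Ioo s t)).prod volume) :=
    integrable_finsetSum _ fun i _ => integrable_finsetSum _ fun j _ => hkprod i j
  have hint_ξ : ∀ r ∈ Ioo s t,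
      ((∑ i, ∑ j, a i j r * gaussAvg d (covMat d a s r) (pdrv d i (pdrv d j φ)) z : ℝ) : ℂ) =
        ∫ ξ, ∑ i, ∑ j, k i j r ξ := by
    intro r hr
    rw [integral_finsetSum _ fun i _ => integrable_finsetSum _ fun j _ => hkξ i j r hr]
    push_cast
    refine Finset.sum_congr rfl fun i _ => ?_
    rw [integral_finsetSum _ fun j _ => hkξ i j r hr]
    refine Finset.sum_congr rfl fun j _ => ?_
    rw [gaussAvg_eq_integral_fourier (hpd r hr) (hG2 i j) (hrep2 i j), ← integral_const_mul]
    refine integral_congr_ae (Filter.Eventually.of_forall fun ξ => ?_)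
    simp only [hk, he, hE]
    ring
  have hint_r : ∀ ξ, ∫ r in Ioo s t, ∑ i, ∑ j, k i j r ξ =
      G ξ * e ξ * (E t ξ : ℂ) - G ξ * e ξ := by
    intro ξ
    have hH : ∀ r, (∀ i j, IntegrableOn (a i j) (Ioo s r)) →
        ∫ q in Ioo s r, 4 * Real.pi ^ 2 * ∑ i, ∑ j, a i j q * ξ i * ξ j =
        2 * Real.pi ^ 2 * ∑ i, ∑ j, covMat d a s r i j * ξ i * ξ j := by
      intro r hr
      rw [integral_const_mul, quadratic_covMat hr]
      ring
    have hftc := setIntegral_mul_exp_neg_setIntegral hst.le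
      (h := fun q => 4 * Real.pi ^ 2 * ∑ i, ∑ j, a i j q * ξ i * ξ j)
      ((integrable_finsetSum _ fun i _ => integrable_finsetSum _ fun j _ =>
        ((hint i j).mul_const _).mul_const _).const_mul _)
      (fun r hr => by
        have h1 := hunif r hr ξ
        have h2 : 0 ≤ ε * ∑ i, ξ i ^ 2 :=
          mul_nonneg hε.le (Finset.sum_nonneg fun i _ => sq_nonneg _)
        have := h2.trans h1
        positivity)
    rw [hH t hint] at hftc
    have h3 : ∀ r ∈ Ioo s t, ∑ i, ∑ j, k i j r ξ = (G ξ * e ξ) *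
        ((-((4 * Real.pi ^ 2 * ∑ i, ∑ j, a i j r * ξ i * ξ j) *
          Real.exp (-∫ q in Ioo s r, 4 * Real.pi ^ 2 * ∑ i, ∑ j, a i j q * ξ i * ξ j)) : ℝ) :
          ℂ) := by
      intro r hr
      rw [hH r fun i j => (hint i j).mono_set (hsub r hr)]
      simp only [hk, hE]
      push_cast
      simp only [Finset.mul_sum, Finset.sum_mul, ← Finset.sum_neg_distrib]
      refine Finset.sum_congr rfl fun i _ => Finset.sum_congr rfl fun j _ => ?_
      ring
    rw [setIntegral_congr_fun measurableSet_Ioo h3, integral_const_mul, integral_complex_ofReal,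
      integral_neg, hftc]
    simp only [hE]
    push_cast
    ring
  have hGe : Integrable fun ξ => G ξ * e ξ := by
    refine (hG.bdd_mul (c := 1) he_cont.aestronglyMeasurable
      (Filter.Eventually.of_forall fun ξ => (he_norm ξ).le)).congr
      (Filter.Eventually.of_forall fun ξ => mul_comm _ _)
  have hGeE : Integrable fun ξ => G ξ * e ξ * (E t ξ : ℂ) := by
    refine hGe.mul_bdd (c := 1) (Measurable.aestronglyMeasurable ?_)
      (Filter.Eventually.of_forall fun ξ => ?_)
    · exact Complex.measurable_ofReal.comp (hE_meas' t)
    · exact hE_norm t ξ hpdt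
  have hfinal : ((∫ r in Ioo s t, ∑ i, ∑ j,
      a i j r * gaussAvg d (covMat d a s r) (pdrv d i (pdrv d j φ)) z : ℝ) : ℂ) =
      (gaussAvg d (covMat d a s t) φ z : ℂ) - (φ z : ℂ) := by
    rw [← integral_complex_ofReal, setIntegral_congr_fun measurableSet_Ioo hint_ξ,
      integral_integral_swap hKprod]
    simp only [hint_r]
    rw [integral_sub hGeE hGe, gaussAvg_eq_integral_fourier hpdt hG hrep, hrep]
    simp only [he, hE]
  rw [← Complex.ofReal_sub] at hfinal
  have := Complex.ofReal_injective hfinal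
  linarith

/-! ### Measurability, bounds and symmetry of Gaussian averages -/

theorem measurable_gaussAvg_covMat {α : Type*} [MeasurableSpace α] {d : ℕ}
    {a : Fin d → Fin d → ℝ → ℝ} (ha : ∀ i j, Measurable (a i j)) {s t : α → ℝ}
    (hs : Measurable s) (ht : Measurable t) {ψ : α → Rd d → ℝ}
    (hψ : Measurable (Function.uncurry ψ)) {z : α → Rd d} (hz : Measurable z) :
    Measurable fun x => gaussAvg d (covMat d a (s x) (t x)) (ψ x) (z x) := by
  have h1 : Measurable fun p : α × Rd d => ψ p.1 (z p.1 + p.2) :=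
    hψ.comp (measurable_fst.prodMk ((hz.comp measurable_fst).add measurable_snd))
  have h2 : Measurable fun p : α × Rd d => gaussKernel d (covMat d a (s p.1) (t p.1)) p.2 :=
    measurable_gaussKernel_comp
      (fun i j => (measurable_covMat_apply ha i j).comp
        ((hs.comp measurable_fst).prodMk (ht.comp measurable_fst)))
      measurable_snd
  exact ((h1.mul h2).stronglyMeasurable.integral_prod_right').measurable

theorem abs_gaussAvg_le {d : ℕ} {S : Matrix (Fin d) (Fin d) ℝ} (hS : S.PosDef) {g : Rd d → ℝ}
    {M : ℝ} (hM : ∀ x, |g x| ≤ M) (z : Rd d) : |gaussAvg d S g z| ≤ M := by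
  have h1 : ‖∫ y, g (z + y) * gaussKernel d S y‖ ≤ ∫ y, M * gaussKernel d S y := by
    refine norm_integral_le_of_norm_le ((integrable_gaussKernel hS).const_mul M)
      (Filter.Eventually.of_forall fun y => ?_)
    rw [norm_mul, Real.norm_of_nonneg (gaussKernel_nonneg hS y)]
    exact mul_le_mul_of_nonneg_right (hM _) (gaussKernel_nonneg hS y)
  rwa [integral_const_mul, integral_gaussKernel hS, mul_one] at h1

theorem gaussAvg_const {d : ℕ} {S : Matrix (Fin d) (Fin d) ℝ} (hS : S.PosDef) (c : ℝ)
    (z : Rd d) : gaussAvg d S (fun _ => c) z = c := by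
  rw [gaussAvg, integral_const_mul, integral_gaussKernel hS, mul_one]

theorem integrable_mul_gaussKernel_prod {d : ℕ} {S : Matrix (Fin d) (Fin d) ℝ} (hS : S.PosDef)
    {ψ : Rd d → ℝ} (hψ : Integrable ψ) :
    Integrable (fun p : Rd d × Rd d => ψ (p.1 + p.2) * gaussKernel d S p.2)
      (volume.prod volume) :=
  (measurePreserving_add_prod volume volume).integrable_comp_of_integrable
    (hψ.mul_prod (integrable_gaussKernel hS))

theorem integrable_gaussAvg {d : ℕ} {S : Matrix (Fin d) (Fin d) ℝ} (hS : S.PosDef)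
    {ψ : Rd d → ℝ} (hψ : Integrable ψ) : Integrable (gaussAvg d S ψ) :=
  (integrable_mul_gaussKernel_prod hS hψ).integral_prod_left

/-- Averaging against a centered Gaussian is a symmetric operation. -/
theorem integral_gaussAvg_mul {d : ℕ} {S : Matrix (Fin d) (Fin d) ℝ} (hS : S.PosDef)
    {g ψ : Rd d → ℝ} (hg : Measurable g) {M : ℝ} (hM : ∀ x, |g x| ≤ M) (hψ : Integrable ψ) :
    ∫ x, gaussAvg d S g x * ψ x = ∫ z, g z * gaussAvg d S ψ z := by
  have h1 : Integrable (Function.uncurry fun x y : Rd d =>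
      g (x + y) * (ψ x * gaussKernel d S y)) (volume.prod volume) :=
    (hψ.mul_prod (integrable_gaussKernel hS)).bdd_mul (c := M)
      (hg.comp (measurable_fst.add measurable_snd)).aestronglyMeasurable
      (Filter.Eventually.of_forall fun p => hM _)
  have h2 : Integrable (Function.uncurry fun z y : Rd d =>
      g z * (ψ (z + y) * gaussKernel d S y)) (volume.prod volume) :=
    (integrable_mul_gaussKernel_prod hS hψ).bdd_mul (c := M)
      (hg.comp measurable_fst).aestronglyMeasurable
      (Filter.Eventually.of_forall fun p => hM _)
  calc ∫ x, gaussAvg d S g x * ψ x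
      = ∫ x, ∫ y, g (x + y) * (ψ x * gaussKernel d S y) := by
        simp only [gaussAvg, ← integral_mul_const]
        refine integral_congr_ae (Filter.Eventually.of_forall fun x =>
          integral_congr_ae (Filter.Eventually.of_forall fun y => ?_))
        simp only
        ring
    _ = ∫ y, ∫ x, g (x + y) * (ψ x * gaussKernel d S y) := integral_integral_swap h1
    _ = ∫ y, ∫ x, g (x + -y) * (ψ x * gaussKernel d S y) := by
        rw [← integral_neg_eq_self]
        simp only [gaussKernel_neg]
    _ = ∫ y, ∫ z, g z * (ψ (z + y) * gaussKernel d S y) := by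
        refine integral_congr_ae (Filter.Eventually.of_forall fun y => ?_)
        simp only
        rw [← integral_add_right_eq_self _ y]
        simp only [add_neg_cancel_right]
    _ = ∫ z, ∫ y, g z * (ψ (z + y) * gaussKernel d S y) := (integral_integral_swap h2).symm
    _ = ∫ z, g z * gaussAvg d S ψ z := by simp only [gaussAvg, integral_const_mul]

theorem integral_abs_gaussAvg_le {d : ℕ} {S : Matrix (Fin d) (Fin d) ℝ} (hS : S.PosDef)
    {ψ : Rd d → ℝ} (hψ : Integrable ψ) : ∫ z, |gaussAvg d S ψ z| ≤ ∫ x, |ψ x| := by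
  have h1 : ∫ z, gaussAvg d S (fun x => |ψ x|) z = ∫ x, |ψ x| := by
    have := integral_gaussAvg_mul hS (g := fun _ => 1) measurable_const (M := 1) (by simp) hψ.abs
    simpa [gaussAvg_const hS] using this.symm
  rw [← h1]
  refine integral_mono (integrable_gaussAvg hS hψ).abs (integrable_gaussAvg hS hψ.abs) fun z => ?_
  refine (abs_integral_le_integral_abs).trans_eq ?_
  refine integral_congr_ae (Filter.Eventually.of_forall fun y => ?_)
  simp only [abs_mul, abs_of_nonneg (gaussKernel_nonneg hS y)]

theorem abs_integral_mul_gaussAvg_le {d : ℕ} {S : Matrix (Fin d) (Fin d) ℝ} (hS : S.PosDef)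
    {g ψ : Rd d → ℝ} {M : ℝ} (hM : ∀ x, |g x| ≤ M) (hψ : Integrable ψ) :
    ∫ z, |g z * gaussAvg d S ψ z| ≤ M * ∫ x, |ψ x| := by
  have hM0 : 0 ≤ M := (abs_nonneg _).trans (hM 0)
  refine le_trans ?_ (mul_le_mul_of_nonneg_left (integral_abs_gaussAvg_le hS hψ) hM0)
  rw [← integral_const_mul]
  refine integral_mono_of_nonneg (Filter.Eventually.of_forall fun z => abs_nonneg _)
    ((integrable_gaussAvg hS hψ).abs.const_mul M) (Filter.Eventually.of_forall fun z => ?_)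
  simp only [abs_mul]
  exact mul_le_mul_of_nonneg_right (hM z) (abs_nonneg _)

/-! ### The Gaussian potential -/

/-- The space-time potential `u(t,x) = ∫_0^t ∫ f(s, x + y) p_{s,t}(y) dy ds`. -/
def gaussPotential (d : ℕ) (a : Fin d → Fin d → ℝ → ℝ) (f : ℝ → Rd d → ℝ) (t : ℝ)
    (x : Rd d) : ℝ :=
  ∫ s in Ioo (0 : ℝ) t, gaussAvg d (covMat d a s t) (f s) x

theorem setIntegral_Ioo_eq_integral_ite (F : ℝ → ℝ) (s t : ℝ) :
    ∫ r in Ioo s t, F r = ∫ r, if s < r ∧ r < t then F r else 0 := by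
  rw [← integral_indicator measurableSet_Ioo]
  simp only [indicator, mem_Ioo]

theorem measurable_gaussPotential {d : ℕ} {a : Fin d → Fin d → ℝ → ℝ}
    (ha : ∀ i j, Measurable (a i j)) {f : ℝ → Rd d → ℝ}
    (hf : Measurable (Function.uncurry f)) :
    Measurable (Function.uncurry (gaussPotential d a f)) := by
  have h1 : Measurable fun q : (ℝ × Rd d) × ℝ =>
      gaussAvg d (covMat d a q.2 q.1.1) (f q.2) q.1.2 :=
    measurable_gaussAvg_covMat ha measurable_snd (measurable_fst.comp measurable_fst)
      (ψ := fun q : (ℝ × Rd d) × ℝ => f q.2)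
      (hf.comp ((measurable_snd.comp measurable_fst).prodMk measurable_snd))
      (measurable_snd.comp measurable_fst)
  have h2 : Measurable fun q : (ℝ × Rd d) × ℝ =>
      if 0 < q.2 ∧ q.2 < q.1.1 then gaussAvg d (covMat d a q.2 q.1.1) (f q.2) q.1.2 else 0 :=
    Measurable.ite ((measurableSet_lt measurable_const measurable_snd).inter
      (measurableSet_lt measurable_snd (measurable_fst.comp measurable_fst))) h1 measurable_const
  have h3 : Function.uncurry (gaussPotential d a f) = fun p => ∫ s, if 0 < s ∧ s < p.1 then
      gaussAvg d (covMat d a s p.1) (f s) p.2 else 0 :=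
    funext fun p => setIntegral_Ioo_eq_integral_ite _ _ _
  rw [h3]
  exact (h2.stronglyMeasurable.integral_prod_right').measurable

theorem abs_gaussPotential_le {d : ℕ} {a : Fin d → Fin d → ℝ → ℝ} {t : ℝ} (ht : 0 ≤ t)
    (hpd : ∀ s ∈ Ioo 0 t, (covMat d a s t).PosDef) {f : ℝ → Rd d → ℝ} {M : ℝ}
    (hM : ∀ s x, |f s x| ≤ M) (x : Rd d) : |gaussPotential d a f t x| ≤ M * t := by
  have := norm_setIntegral_le_of_norm_le_const (μ := volume) (s := Ioo 0 t)
    (f := fun s => gaussAvg d (covMat d a s t) (f s) x) (C := M) (by simp)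
    fun s hs => abs_gaussAvg_le (hpd s hs) (hM s) x
  rwa [Real.volume_real_Ioo_of_le ht, sub_zero] at this

theorem locInt_gaussPotential {d : ℕ} {a : Fin d → Fin d → ℝ → ℝ}
    (ha : ∀ i j, Measurable (a i j)) {T : ℝ}
    (hpd : ∀ s t, 0 < s → s < t → t < T → (covMat d a s t).PosDef) {f : ℝ → Rd d → ℝ}
    (hf : Measurable (Function.uncurry f)) {M : ℝ} (hM : ∀ s x, |f s x| ≤ M) :
    LocInt d T (gaussPotential d a f) := by
  refine ⟨measurable_gaussPotential ha hf, fun t ht R hR => ?_⟩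
  have hM0 : 0 ≤ M := (abs_nonneg _).trans (hM 0 0)
  set B : Set (Rd d) := {x : Rd d | ∑ i, x i ^ 2 < R ^ 2}
  have hB : volume B < ⊤ := by
    refine (measure_mono fun x hx => ?_).trans_lt
      (isCompact_closedBall (0 : Rd d) R).measure_lt_top
    rw [mem_closedBall_zero_iff, pi_norm_le_iff_of_nonneg hR.le]
    intro i
    have h1 : x i ^ 2 ≤ ∑ i, x i ^ 2 :=
      Finset.single_le_sum (f := fun i => x i ^ 2) (fun i _ => sq_nonneg _) (Finset.mem_univ i)
    exact abs_le_of_sq_le_sq (h1.trans (le_of_lt hx)) hR.le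
  calc ∫⁻ s in Ioo (0 : ℝ) t, ∫⁻ x in B, ENNReal.ofReal |gaussPotential d a f s x|
      ≤ ∫⁻ s in Ioo (0 : ℝ) t, ∫⁻ x in B, ENNReal.ofReal (M * t) := by
        refine setLIntegral_mono measurable_const fun s hs =>
          lintegral_mono fun x => ENNReal.ofReal_le_ofReal ?_
        refine (abs_gaussPotential_le hs.1.le
          (fun r hr => hpd r s hr.1 hr.2 (hs.2.trans ht.2)) hM x).trans ?_
        exact mul_le_mul_of_nonneg_left hs.2.le hM0
    _ < ⊤ := by
        simp only [lintegral_const, Measure.restrict_apply_univ, Real.volume_Ioo]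
        exact ENNReal.mul_lt_top (ENNReal.mul_lt_top ENNReal.ofReal_lt_top hB)
          ENNReal.ofReal_lt_top

theorem integral_gaussPotential_mul {d : ℕ} {a : Fin d → Fin d → ℝ → ℝ}
    (ha : ∀ i j, Measurable (a i j)) {t : ℝ} (hpd : ∀ s ∈ Ioo 0 t, (covMat d a s t).PosDef)
    {f : ℝ → Rd d → ℝ} (hf : Measurable (Function.uncurry f)) {M : ℝ}
    (hM : ∀ s x, |f s x| ≤ M) {ψ : Rd d → ℝ} (hψ : Integrable ψ) :
    ∫ x, gaussPotential d a f t x * ψ x =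
      ∫ s in Ioo (0 : ℝ) t, ∫ z, f s z * gaussAvg d (covMat d a s t) ψ z := by
  have h1 : Integrable (Function.uncurry fun (s : ℝ) (x : Rd d) =>
      gaussAvg d (covMat d a s t) (f s) x * ψ x)
      ((volume.restrict (Ioo 0 t)).prod volume) := by
    refine Integrable.bdd_mul (c := M) (g := fun p : ℝ × Rd d => ψ p.2) (hψ.comp_snd _)
      (Measurable.aestronglyMeasurable ?_) ?_
    · exact measurable_gaussAvg_covMat ha measurable_fst measurable_const
        (ψ := fun p : ℝ × Rd d => f p.1)
        (hf.comp ((measurable_fst.comp measurable_fst).prodMk measurable_snd)) measurable_snd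
    · have h2 : ∀ᵐ s ∂(volume.restrict (Ioo 0 t)), s ∈ Ioo 0 t :=
        ae_restrict_mem measurableSet_Ioo
      filter_upwards [Measure.quasiMeasurePreserving_fst.ae h2] with p hp
      exact abs_gaussAvg_le (hpd p.1 hp) (hM p.1) p.2
  simp only [gaussPotential, ← integral_mul_const]
  rw [← integral_integral_swap h1]
  refine setIntegral_congr_fun measurableSet_Ioo fun s hs => ?_
  exact integral_gaussAvg_mul (hpd s hs) (hf.comp measurable_prodMk_left) (hM s) hψ

/-! ### The potential is a weak solution -/

theorem measurable_integral_mul_gaussAvg {d : ℕ} {a : Fin d → Fin d → ℝ → ℝ}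
    (ha : ∀ i j, Measurable (a i j)) {f : ℝ → Rd d → ℝ} (hf : Measurable (Function.uncurry f))
    {ψ : Rd d → ℝ} (hψ : Measurable ψ) :
    Measurable fun p : ℝ × ℝ => ∫ z, f p.1 z * gaussAvg d (covMat d a p.1 p.2) ψ z := by
  have h1 : Measurable fun q : (ℝ × ℝ) × Rd d =>
      gaussAvg d (covMat d a q.1.1 q.1.2) ψ q.2 :=
    measurable_gaussAvg_covMat ha (measurable_fst.comp measurable_fst)
      (measurable_snd.comp measurable_fst) (ψ := fun _ => ψ) (hψ.comp measurable_snd)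
      measurable_snd
  have h2 : Measurable fun q : (ℝ × ℝ) × Rd d => f q.1.1 q.2 :=
    hf.comp ((measurable_fst.comp measurable_fst).prodMk measurable_snd)
  exact ((h2.mul h1).stronglyMeasurable.integral_prod_right').measurable

/-- Fubini's theorem on the triangle `0 < s < r < t`. -/
theorem setIntegral_setIntegral_triangle {H : ℝ → ℝ → ℝ} {t : ℝ}
    (hH : Integrable (fun p : ℝ × ℝ => if 0 < p.1 ∧ p.1 < p.2 ∧ p.2 < t then H p.1 p.2 else 0)
      (volume.prod volume)) :
    IntegrableOn (fun s => ∫ r in Ioo s t, H s r) (Ioo 0 t) ∧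
    IntegrableOn (fun r => ∫ s in Ioo 0 r, H s r) (Ioo 0 t) ∧
    ∫ s in Ioo 0 t, ∫ r in Ioo s t, H s r = ∫ r in Ioo 0 t, ∫ s in Ioo 0 r, H s r := by
  have h1 : ∀ s, (∫ r, if 0 < s ∧ s < r ∧ r < t then H s r else 0) =
      (Ioo 0 t).indicator (fun s => ∫ r in Ioo s t, H s r) s := by
    intro s
    by_cases hs : s ∈ Ioo 0 t
    · rw [indicator_of_mem hs, setIntegral_Ioo_eq_integral_ite]
      simp only [hs.1, true_and]
    · rw [indicator_of_notMem hs]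
      refine integral_eq_zero_of_ae (Filter.Eventually.of_forall fun r => if_neg fun h => hs ?_)
      exact ⟨h.1, h.2.1.trans h.2.2⟩
  have h2 : ∀ r, (∫ s, if 0 < s ∧ s < r ∧ r < t then H s r else 0) =
      (Ioo 0 t).indicator (fun r => ∫ s in Ioo 0 r, H s r) r := by
    intro r
    by_cases hr : r ∈ Ioo 0 t
    · rw [indicator_of_mem hr, setIntegral_Ioo_eq_integral_ite]
      simp only [hr.2, and_true]
    · rw [indicator_of_notMem hr]
      refine integral_eq_zero_of_ae (Filter.Eventually.of_forall fun s => if_neg fun h => hr ?_)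
      exact ⟨h.1.trans h.2.1, h.2.2⟩
  have h3 := hH.integral_prod_left
  have h4 := hH.integral_prod_right
  have h5 := integral_integral_swap
    (f := fun s r : ℝ => if 0 < s ∧ s < r ∧ r < t then H s r else 0) hH
  simp only [h1] at h3 h5
  simp only [h2] at h4 h5
  refine ⟨(integrable_indicator_iff measurableSet_Ioo).1 h3,
    (integrable_indicator_iff measurableSet_Ioo).1 h4, ?_⟩
  rwa [integral_indicator measurableSet_Ioo, integral_indicator measurableSet_Ioo] at h5

theorem integrable_triangle_mul {w : ℝ → ℝ} (hw : Measurable w) {t : ℝ}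
    (hwi : IntegrableOn w (Ioo 0 t)) {F : ℝ → ℝ → ℝ} (hF : Measurable (Function.uncurry F))
    {C : ℝ} (hC : ∀ s r, 0 < s → s < r → r < t → |F s r| ≤ C) :
    Integrable (fun p : ℝ × ℝ =>
      if 0 < p.1 ∧ p.1 < p.2 ∧ p.2 < t then w p.2 * F p.1 p.2 else 0)
      (volume.prod volume) := by
  have h1 : Integrable ((Ioo 0 t).indicator fun _ : ℝ => C) :=
    (integrable_indicator_iff measurableSet_Ioo).2 (integrableOn_const (by simp))
  have h2 : Integrable ((Ioo 0 t).indicator w) :=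
    (integrable_indicator_iff measurableSet_Ioo).2 hwi
  refine (h1.mul_prod h2.norm).mono' (Measurable.aestronglyMeasurable ?_)
    (Filter.Eventually.of_forall fun p => ?_)
  · exact Measurable.ite ((measurableSet_lt measurable_const measurable_fst).inter
      ((measurableSet_lt measurable_fst measurable_snd).inter
        (measurableSet_lt measurable_snd measurable_const)))
      ((hw.comp measurable_snd).mul hF) measurable_const
  · split_ifs with hp
    · rw [indicator_of_mem (show p.1 ∈ Ioo 0 t from ⟨hp.1, hp.2.1.trans hp.2.2⟩),
        indicator_of_mem (show p.2 ∈ Ioo 0 t from ⟨hp.1.trans hp.2.1, hp.2.2⟩), norm_mul, mul_comm]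
      exact mul_le_mul_of_nonneg_right (hC _ _ hp.1 hp.2.1 hp.2.2) (norm_nonneg _)
    · rw [norm_zero]
      by_cases h : p.1 ∈ Ioo 0 t ∧ p.2 ∈ Ioo 0 t
      · have hC0 : 0 ≤ C := (abs_nonneg _).trans
          (hC (p.1 / 3) (p.1 / 2) (by linarith [h.1.1]) (by linarith [h.1.1])
            (by linarith [h.1.1, h.1.2]))
        rw [indicator_of_mem h.1]
        exact mul_nonneg hC0 (norm_nonneg _)
      · rcases not_and_or.1 h with h | h <;> simp [indicator_of_notMem h]

theorem integrable_mul_gaussAvg_prod {d : ℕ} {a : Fin d → Fin d → ℝ → ℝ}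
    (ha : ∀ i j, Measurable (a i j)) {s t : ℝ}
    (hpd : ∀ r ∈ Ioo s t, (covMat d a s r).PosDef) {w : ℝ → ℝ} (hw : Measurable w)
    (hwi : IntegrableOn w (Ioo s t)) {g : Rd d → ℝ} (hg : Measurable g) {M : ℝ}
    (hM : ∀ x, |g x| ≤ M) {ψ : Rd d → ℝ} (hψm : Measurable ψ) (hψ : Integrable ψ) :
    Integrable (Function.uncurry fun (r : ℝ) (z : Rd d) =>
      w r * (g z * gaussAvg d (covMat d a s r) ψ z))
      ((volume.restrict (Ioo s t)).prod volume) := by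
  have hmem : ∀ᵐ r ∂(volume.restrict (Ioo s t)), r ∈ Ioo s t :=
    ae_restrict_mem measurableSet_Ioo
  have hmeas : Measurable fun p : ℝ × Rd d =>
      w p.1 * (g p.2 * gaussAvg d (covMat d a s p.1) ψ p.2) :=
    (hw.comp measurable_fst).mul ((hg.comp measurable_snd).mul
      (measurable_gaussAvg_covMat ha measurable_const measurable_fst
        (ψ := fun _ : ℝ × Rd d => ψ) (hψm.comp measurable_snd) measurable_snd))
  refine (integrable_prod_iff hmeas.aestronglyMeasurable).2 ⟨?_, ?_⟩
  · filter_upwards [hmem] with r hr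
    exact ((integrable_gaussAvg (hpd r hr) hψ).bdd_mul hg.aestronglyMeasurable
      (Filter.Eventually.of_forall hM)).const_mul (w r)
  · refine (hwi.norm.mul_const (M * ∫ x, |ψ x|)).mono'
      hmeas.norm.stronglyMeasurable.integral_prod_right'.aestronglyMeasurable ?_
    filter_upwards [hmem] with r hr
    rw [Real.norm_of_nonneg (integral_nonneg fun z => norm_nonneg _)]
    simp only [norm_mul (w r), integral_const_mul]
    exact mul_le_mul_of_nonneg_left (abs_integral_mul_gaussAvg_le (hpd r hr) hM hψ)
      (norm_nonneg _)

theorem integral_mul_gaussAvg_eq {d : ℕ} {a : Fin d → Fin d → ℝ → ℝ}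
    (ha : ∀ i j, Measurable (a i j)) {s t ε : ℝ} (hst : s < t) (hε : 0 < ε)
    (hint : ∀ i j, IntegrableOn (a i j) (Ioo s t))
    (hsymm : ∀ r ∈ Ioo s t, ∀ i j, a i j r = a j i r)
    (hunif : ∀ r ∈ Ioo s t, ∀ ξ : Fin d → ℝ,
      ε * ∑ i, ξ i ^ 2 ≤ ∑ i, ∑ j, a i j r * ξ i * ξ j)
    {φ : Rd d → ℝ} (hφ : ContDiff ℝ (⊤ : ℕ∞) φ) (hc : HasCompactSupport φ)
    {g : Rd d → ℝ} (hg : Measurable g) {M : ℝ} (hM : ∀ x, |g x| ≤ M) :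
    ∫ z, g z * gaussAvg d (covMat d a s t) φ z = (∫ z, g z * φ z) +
      ∑ i, ∑ j, ∫ r in Ioo s t,
        a i j r * ∫ z, g z * gaussAvg d (covMat d a s r) (pdrv d i (pdrv d j φ)) z := by
  have hsub : ∀ r ∈ Ioo s t, Ioo s r ⊆ Ioo s t := fun r hr => Ioo_subset_Ioo_right hr.2.le
  have hpd : ∀ r ∈ Ioo s t, (covMat d a s r).PosDef := fun r hr =>
    posDef_covMat hr.1 hε (fun i j => (hint i j).mono_set (hsub r hr))
      (fun q hq => hsymm q (hsub r hr hq)) (fun q hq => hunif q (hsub r hr hq))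
  have hψc : ∀ i j, Continuous (pdrv d i (pdrv d j φ)) := fun i j =>
    (contDiff_pdrv (contDiff_pdrv hφ j) i).continuous
  have hψs : ∀ i j, HasCompactSupport (pdrv d i (pdrv d j φ)) := fun i j => (hc.pdrv j).pdrv i
  have hK : ∀ i j, Integrable (Function.uncurry fun (r : ℝ) (z : Rd d) =>
      a i j r * (g z * gaussAvg d (covMat d a s r) (pdrv d i (pdrv d j φ)) z))
      ((volume.restrict (Ioo s t)).prod volume) := fun i j =>
    integrable_mul_gaussAvg_prod ha hpd (ha i j) (hint i j) hg hM (hψc i j).measurable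
      ((hψc i j).integrable_of_hasCompactSupport (hψs i j))
  have hr : ∀ i j z, IntegrableOn
      (fun r => a i j r * gaussAvg d (covMat d a s r) (pdrv d i (pdrv d j φ)) z) (Ioo s t) := by
    intro i j z
    obtain ⟨C, hC⟩ := (hψs i j).exists_bound_of_continuous (hψc i j)
    refine (hint i j).mul_bdd (c := C) (Measurable.aestronglyMeasurable ?_) ?_
    · exact measurable_gaussAvg_covMat ha measurable_const measurable_id
        (ψ := fun _ => pdrv d i (pdrv d j φ)) ((hψc i j).measurable.comp measurable_snd)
        measurable_const
    · filter_upwards [ae_restrict_mem measurableSet_Ioo] with r hr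
      exact abs_gaussAvg_le (hpd r hr) hC z
  have hpt : ∀ z, g z * gaussAvg d (covMat d a s t) φ z = g z * φ z + ∑ i, ∑ j,
      ∫ r in Ioo s t,
        a i j r * (g z * gaussAvg d (covMat d a s r) (pdrv d i (pdrv d j φ)) z) := by
    intro z
    rw [gaussAvg_eq_add_integral ha hst hε hint hsymm hunif hφ hc z, mul_add,
      integral_finsetSum _ fun i _ => integrable_finsetSum _ fun j _ => hr i j z, Finset.mul_sum]
    congr 1
    refine Finset.sum_congr rfl fun i _ => ?_
    rw [integral_finsetSum _ fun j _ => hr i j z, Finset.mul_sum]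
    refine Finset.sum_congr rfl fun j _ => ?_
    rw [← integral_const_mul]
    simp only [mul_left_comm (g z)]
  have hgφ : Integrable fun z => g z * φ z :=
    (hφ.continuous.integrable_of_hasCompactSupport hc).bdd_mul hg.aestronglyMeasurable
      (Filter.Eventually.of_forall hM)
  have hz : ∀ i j, Integrable fun z => ∫ r in Ioo s t,
      a i j r * (g z * gaussAvg d (covMat d a s r) (pdrv d i (pdrv d j φ)) z) := fun i j =>
    (hK i j).integral_prod_right
  simp only [hpt]
  rw [integral_add hgφ (integrable_finsetSum _ fun i _ => integrable_finsetSum _ fun j _ => hz i j),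
    integral_finsetSum _ fun i _ => integrable_finsetSum _ fun j _ => hz i j]
  congr 1
  refine Finset.sum_congr rfl fun i _ => ?_
  rw [integral_finsetSum _ fun j _ => hz i j]
  refine Finset.sum_congr rfl fun j _ => ?_
  rw [← integral_integral_swap (hK i j)]
  simp only [integral_const_mul]

theorem isWeakSol_gaussPotential {d : ℕ} {a : Fin d → Fin d → ℝ → ℝ}
    (ha : ∀ i j, Measurable (a i j)) {T ε : ℝ} (hε : 0 < ε)
    (hint : ∀ i j, IntegrableOn (a i j) (Ioo 0 T))
    (hsymm : ∀ r ∈ Ioo 0 T, ∀ i j, a i j r = a j i r)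
    (hunif : ∀ r ∈ Ioo 0 T, ∀ ξ : Fin d → ℝ,
      ε * ∑ i, ξ i ^ 2 ≤ ∑ i, ∑ j, a i j r * ξ i * ξ j)
    {f : ℝ → Rd d → ℝ} (hf : Measurable (Function.uncurry f)) {M : ℝ}
    (hM : ∀ s x, |f s x| ≤ M) :
    IsWeakSol d T a (fun _ _ => 0) (fun _ => 0) f (gaussPotential d a f) := by
  intro φ hφ hc t ht
  have hsub : ∀ s r, 0 < s → r < T → Ioo s r ⊆ Ioo 0 T := fun s r hs hr =>
    Ioo_subset_Ioo hs.le hr.le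
  have hpd : ∀ s r, 0 < s → s < r → r < T → (covMat d a s r).PosDef := fun s r h0 hsr hr =>
    posDef_covMat hsr hε (fun i j => (hint i j).mono_set (hsub s r h0 hr))
      (fun q hq => hsymm q (hsub s r h0 hr hq)) (fun q hq => hunif q (hsub s r h0 hr hq))
  have hψc : ∀ i j, Continuous (pdrv d i (pdrv d j φ)) := fun i j =>
    (contDiff_pdrv (contDiff_pdrv hφ j) i).continuous
  have hψi : ∀ i j, Integrable (pdrv d i (pdrv d j φ)) := fun i j =>
    (hψc i j).integrable_of_hasCompactSupport ((hc.pdrv j).pdrv i)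
  have hφi : Integrable φ := hφ.continuous.integrable_of_hasCompactSupport hc
  obtain ⟨F, hF⟩ : ∃ F : Fin d → Fin d → ℝ → ℝ → ℝ, ∀ i j s r, F i j s r =
      ∫ z, f s z * gaussAvg d (covMat d a s r) (pdrv d i (pdrv d j φ)) z :=
    ⟨_, fun _ _ _ _ => rfl⟩
  have htri := fun i j => setIntegral_setIntegral_triangle (t := t)
    (H := fun s r => a i j r * F i j s r)
    (integrable_triangle_mul (ha i j) ((hint i j).mono_set (Ioo_subset_Ioo_right ht.2.le))
      (F := F i j) (C := M * ∫ x, |pdrv d i (pdrv d j φ) x|)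
      (by
        rw [show Function.uncurry (F i j) = _ from funext fun p => hF i j p.1 p.2]
        exact measurable_integral_mul_gaussAvg ha hf (hψc i j).measurable)
      (fun s r hs hsr hr => by
        rw [hF]
        exact abs_integral_le_integral_abs.trans
          (abs_integral_mul_gaussAvg_le (hpd s r hs hsr (hr.trans ht.2)) (hM s) (hψi i j))))
  have hu : ∀ r ∈ Ioo 0 t,
      ∫ x, gaussPotential d a f r x * ((∑ i, ∑ j, a i j r * pdrv d i (pdrv d j φ) x)
        + (∑ i, 0 * pdrv d i φ x) + 0 * φ x) =
      ∑ i, ∑ j, ∫ s in Ioo 0 r, a i j r * F i j s r := by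
    intro r hr
    have hpr : ∀ s ∈ Ioo 0 r, (covMat d a s r).PosDef := fun s hs =>
      hpd s r hs.1 hs.2 (hr.2.trans ht.2)
    have h1 : ∀ i j, Integrable fun x =>
        a i j r * (gaussPotential d a f r x * pdrv d i (pdrv d j φ) x) := fun i j =>
      ((hψi i j).bdd_mul ((measurable_gaussPotential ha hf).comp
        measurable_prodMk_left).aestronglyMeasurable (Filter.Eventually.of_forall
          (abs_gaussPotential_le hr.1.le hpr hM))).const_mul _
    simp only [zero_mul, Finset.sum_const_zero, add_zero, Finset.mul_sum,
      mul_left_comm (gaussPotential d a f r _)]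
    rw [integral_finsetSum _ fun i _ => integrable_finsetSum _ fun j _ => h1 i j]
    refine Finset.sum_congr rfl fun i _ => ?_
    rw [integral_finsetSum _ fun j _ => h1 i j]
    refine Finset.sum_congr rfl fun j _ => ?_
    rw [integral_const_mul, integral_const_mul, integral_gaussPotential_mul ha hpr hf hM (hψi i j)]
    simp only [hF]
  have hs : ∀ s ∈ Ioo 0 t, ∫ z, f s z * gaussAvg d (covMat d a s t) φ z =
      (∫ z, f s z * φ z) + ∑ i, ∑ j, ∫ r in Ioo s t, a i j r * F i j s r := by
    intro s hs
    simp only [hF]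
    exact integral_mul_gaussAvg_eq ha hs.2 hε
      (fun i j => (hint i j).mono_set (hsub s t hs.1 ht.2))
      (fun q hq => hsymm q (hsub s t hs.1 ht.2 hq)) (fun q hq => hunif q (hsub s t hs.1 ht.2 hq))
      hφ hc (hf.comp measurable_prodMk_left) (hM s)
  have hfφ : IntegrableOn (fun s => ∫ z, f s z * φ z) (Ioo 0 t) := by
    have h1 : Integrable (fun p : ℝ × Rd d => f p.1 p.2 * φ p.2)
        ((volume.restrict (Ioo 0 t)).prod volume) :=
      (hφi.comp_snd _).bdd_mul hf.aestronglyMeasurable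
        (Filter.Eventually.of_forall fun p => hM p.1 p.2)
    exact h1.integral_prod_left
  rw [integral_gaussPotential_mul ha (fun s hs => hpd s t hs.1 hs.2 ht.2) hf hM hφi,
    setIntegral_congr_fun measurableSet_Ioo hs, setIntegral_congr_fun measurableSet_Ioo hu,
    integral_add hfφ (integrable_finsetSum _ fun i _ => integrable_finsetSum _ fun j _ =>
      (htri i j).1), add_comm]
  congr 1
  rw [integral_finsetSum _ fun i _ => integrable_finsetSum _ fun j _ => (htri i j).1,
    integral_finsetSum _ fun i _ => integrable_finsetSum _ fun j _ => (htri i j).2.1]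
  refine Finset.sum_congr rfl fun i _ => ?_
  rw [integral_finsetSum _ fun j _ => (htri i j).1, integral_finsetSum _ fun j _ => (htri i j).2.1]
  exact Finset.sum_congr rfl fun j _ => (htri i j).2.2

/-- for bounded measurable `f`, the Gaussian representation
`u(t,x) = ∫_0^t ∫ f(s,x+y) p_{s,t}(y) dy ds` is a locally integrable weak
solution of `∂ₜu = aⁱʲ(t) u_{xⁱxʲ} + f`, `u(0,·)=0`. -/
theorem stmt3 (d : ℕ) (hd : 0 < d) (T : ℝ) (hT : 0 < T)
    (a : Fin d → Fin d → ℝ → ℝ)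
    (ha_meas : ∀ i j, Measurable (a i j))
    (ha_symm : ∀ t ∈ Set.Ioo (0:ℝ) T, ∀ i j, a i j t = a j i t)
    (ha_nonneg : ∀ t ∈ Set.Ioo (0:ℝ) T, ∀ ξ : Fin d → ℝ,
      0 ≤ ∑ i, ∑ j, a i j t * ξ i * ξ j)
    (ha_int : (∫⁻ t in Set.Ioo (0:ℝ) T,
      ENNReal.ofReal (∑ i, ∑ j, |a i j t|)) < ⊤)
    (ε : ℝ) (hε : 0 < ε)
    (hunif : ∀ r ∈ Set.Ioo (0:ℝ) T, ∀ ξ : Fin d → ℝ,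
      ε * ∑ i, ξ i ^ 2 ≤ ∑ i, ∑ j, a i j r * ξ i * ξ j)
    (f : ℝ → Rd d → ℝ) (hf_meas : Measurable (Function.uncurry f))
    (hf_bdd : ∃ M : ℝ, ∀ s x, |f s x| ≤ M) :
    LocInt d T (fun t x => ∫ s in Set.Ioo (0:ℝ) t,
      ∫ y, f s (x + y) * gaussKernel d (covMat d a s t) y) ∧
    IsWeakSol d T a (fun _ _ => 0) (fun _ => 0) f
      (fun t x => ∫ s in Set.Ioo (0:ℝ) t,
        ∫ y, f s (x + y) * gaussKernel d (covMat d a s t) y) := by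
  obtain ⟨M, hM⟩ := hf_bdd
  have hint : ∀ i j, IntegrableOn (a i j) (Ioo 0 T) := by
    intro i j
    refine ⟨(ha_meas i j).aestronglyMeasurable, lt_of_le_of_lt (lintegral_mono fun t => ?_) ha_int⟩
    rw [Real.enorm_eq_ofReal_abs]
    refine ENNReal.ofReal_le_ofReal ?_
    have h1 : ∑ j', |a i j' t| ≤ ∑ i', ∑ j', |a i' j' t| :=
      Finset.single_le_sum (f := fun i' => ∑ j', |a i' j' t|)
        (fun i' _ => Finset.sum_nonneg fun j' _ => abs_nonneg _) (Finset.mem_univ i)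
    exact (Finset.single_le_sum (f := fun j' => |a i j' t|) (fun j' _ => abs_nonneg _)
      (Finset.mem_univ j)).trans h1
  have hsub : ∀ s t, 0 < s → t < T → Ioo s t ⊆ Ioo 0 T := fun s t hs ht =>
    Ioo_subset_Ioo hs.le ht.le
  have hpd : ∀ s t, 0 < s → s < t → t < T → (covMat d a s t).PosDef := fun s t h0 hst ht =>
    posDef_covMat hst hε (fun i j => (hint i j).mono_set (hsub s t h0 ht))
      (fun q hq => ha_symm q (hsub s t h0 ht hq)) (fun q hq => hunif q (hsub s t h0 ht hq))
  exact ⟨locInt_gaussPotential ha_meas hpd hf_meas hM,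
    isWeakSol_gaussPotential ha_meas hε hint ha_symm hunif hf_meas hM⟩
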